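/- Discrete isoperimetric (DeGiorgi) inequality: Let u ∈ W^{1,1}(K_ρ) on a cube K_ρ ⊂ ℝ^N, and let 0 < h < ℓ. Then (ℓ - h) |[u < h] ∩ K_ρ| ≤ C(N) ρ^{N+1} / |[u > ℓ] ∩ K_ρ| · ∫_{[h < u < ℓ] ∩ K_ρ} |Du| dx, provided |[u > ℓ] ∩ K_ρ| > 0. -/

import Mathlib

open MeasureTheory Set

/-- The open cube of edge `2ρ` centered at `y` in `ℝ^N`. -/
def cube (N : ℕ) (y : Fin N → ℝ) (ρ : ℝ) : Set (Fin N → ℝ) :=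
  {x | ∀ i, |x i - y i| < ρ}

section helpers
open Filter Topology
open scoped Convolution

lemma exists_cutoff : ∃ M : ℝ, 0 < M ∧ ∀ h ℓ : ℝ, h < ℓ → ∃ Φ : ℝ → ℝ, ContDiff ℝ 1 Φ ∧
    (∀ t ≤ h, Φ t = 0) ∧ (∀ t, ℓ ≤ t → Φ t = ℓ - h) ∧ (∀ t, |deriv Φ t| ≤ M) ∧
    (∀ t, ¬ (h < t ∧ t < ℓ) → deriv Φ t = 0) := by
  have hS : ContDiff ℝ 1 Real.smoothTransition := Real.smoothTransition.contDiff
  have hc : Continuous (deriv Real.smoothTransition) := hS.continuous_deriv le_rfl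
  have h0 : ∀ t, ¬ (0 < t ∧ t < 1) → deriv Real.smoothTransition t = 0 := by
    intro t ht
    by_cases h1 : t ≤ 0
    · apply IsLocalMin.deriv_eq_zero
      refine Filter.Eventually.of_forall fun s => ?_
      rw [Real.smoothTransition.zero_of_nonpos h1]
      exact Real.smoothTransition.nonneg s
    · have h2 : 1 ≤ t := by
        by_contra h3
        exact ht ⟨not_le.1 h1, not_le.1 h3⟩
      apply IsLocalMax.deriv_eq_zero
      refine Filter.Eventually.of_forall fun s => ?_
      rw [Real.smoothTransition.one_of_one_le h2]
      exact Real.smoothTransition.le_one s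
  obtain ⟨M, hM⟩ := (isCompact_Icc (a := (0:ℝ)) (b := 1)).exists_bound_of_continuousOn hc.continuousOn
  refine ⟨|M| + 1, by positivity, fun h ℓ hl => ?_⟩
  have hpos : 0 < ℓ - h := sub_pos.2 hl
  have hd : ∀ t, HasDerivAt (fun t => (ℓ - h) * Real.smoothTransition ((t - h) / (ℓ - h)))
      (deriv Real.smoothTransition ((t - h) / (ℓ - h))) t := by
    intro t
    have e1 : HasDerivAt (fun t : ℝ => (t - h) / (ℓ - h)) (1 / (ℓ - h)) t :=
      ((hasDerivAt_id t).sub_const h).div_const _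
    have e2 := ((hS.differentiable one_ne_zero ((t - h) / (ℓ - h))).hasDerivAt.comp t e1).const_mul (ℓ - h)
    have e3 : (ℓ - h) * (deriv Real.smoothTransition ((t - h) / (ℓ - h)) * (1 / (ℓ - h))) =
        deriv Real.smoothTransition ((t - h) / (ℓ - h)) := by
      field_simp
    rw [e3] at e2
    exact e2
  refine ⟨fun t => (ℓ - h) * Real.smoothTransition ((t - h) / (ℓ - h)), ?_, ?_, ?_, ?_, ?_⟩
  · exact contDiff_const.mul (hS.comp ((contDiff_id.sub contDiff_const).div_const _))
  · intro t ht
    simp only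
    rw [Real.smoothTransition.zero_of_nonpos (div_nonpos_of_nonpos_of_nonneg (by linarith) hpos.le), mul_zero]
  · intro t ht
    simp only
    rw [Real.smoothTransition.one_of_one_le ((one_le_div hpos).2 (by linarith)), mul_one]
  · intro t
    rw [(hd t).deriv]
    by_cases h1 : 0 < (t - h) / (ℓ - h) ∧ (t - h) / (ℓ - h) < 1
    · have := hM _ ⟨h1.1.le, h1.2.le⟩
      rw [Real.norm_eq_abs] at this
      linarith [le_abs_self M]
    · rw [h0 _ h1, abs_zero]; positivity
  · intro t ht
    rw [(hd t).deriv]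
    apply h0
    rintro ⟨h1, h2⟩
    rw [div_lt_one hpos] at h2
    have := (div_pos_iff_of_pos_right hpos).1 h1
    exact ht ⟨by linarith, by linarith⟩


lemma liminf_add_le_of_le {a b : ℕ → ENNReal} {T : ENNReal} (h : ∀ᶠ n in atTop, a n + b n ≤ T) :
    liminf a atTop + liminf b atTop ≤ T := by
  rw [liminf_eq_iSup_iInf_of_nat, liminf_eq_iSup_iInf_of_nat]
  rw [ENNReal.iSup_add_iSup_of_monotone]
  · refine iSup_le fun n => ?_
    obtain ⟨m, hm⟩ := eventually_atTop.1 h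
    refine le_trans ?_ (hm (max n m) (le_max_right _ _))
    exact add_le_add (iInf₂_le _ (le_max_left _ _)) (iInf₂_le _ (le_max_left _ _))
  · intro i j hij
    exact le_iInf₂ fun k hk => iInf₂_le _ (le_trans hij hk)
  · intro i j hij
    exact le_iInf₂ fun k hk => iInf₂_le _ (le_trans hij hk)

lemma cov_le {N : ℕ} {G : (Fin N → ℝ) → ℝ} (hG : Continuous G) (z : Fin N → ℝ) {t : ℝ}
    (ht : t ≤ 1 / 2) :
    ∫⁻ x, ENNReal.ofReal (G (x + t • (z - x))) ≤ ENNReal.ofReal (2 ^ N) * ∫⁻ x, ENNReal.ofReal (G x) := by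
  have h1 : (1 - t) ≠ 0 := by linarith
  have e1 : ∫⁻ x, ENNReal.ofReal (G (x + t • (z - x)))
      = ∫⁻ x, (fun ξ => ENNReal.ofReal (G (ξ + t • z))) ((1 - t) • x) := by
    congr 1; ext x; simp only; congr 2; module
  have hm : Measurable (fun ξ => ENNReal.ofReal (G (ξ + t • z))) := by
    have : Continuous (fun ξ => G (ξ + t • z)) := by fun_prop
    exact this.measurable.ennreal_ofReal
  rw [e1, ← lintegral_map hm (by fun_prop), Measure.map_addHaar_smul _ h1, lintegral_smul_measure,
    lintegral_add_right_eq_self (fun ξ => ENNReal.ofReal (G ξ)) (t • z), smul_eq_mul]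
  gcongr
  rw [Module.finrank_fin_fun, abs_of_nonneg (by have : 0 ≤ 1 - t := by linarith
                                                positivity)]
  rw [← inv_pow]
  have h2 : 0 < 1 - t := by linarith
  gcongr
  rw [inv_le_comm₀ h2 two_pos]; linarith

lemma poincare {N : ℕ} (y : Fin N → ℝ) {r : ℝ} (hr : 0 < r) {w : (Fin N → ℝ) → ℝ}
    (hw : ContDiff ℝ 1 w) {G : (Fin N → ℝ) → ℝ} (hG : Continuous G) (hG0 : ∀ x, 0 ≤ G x)
    {D : ℝ} (hD0 : 0 ≤ D) (hD : ∀ x ∈ Metric.ball y r, ‖fderiv ℝ w x‖ ≤ D * G x) :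
    ∫⁻ z in Metric.ball y r, ∫⁻ x in Metric.ball y r, ENNReal.ofReal |w x - w z| ≤
      ENNReal.ofReal (D * (2 * r) * (2 * r) ^ N * 2 ^ N) * ∫⁻ x, ENNReal.ofReal (G x) := by
  set B := Metric.ball y r with hB
  set P : (Fin N → ℝ) → (Fin N → ℝ) → ENNReal := fun x z => ENNReal.ofReal (2 * r * D) *
    ∫⁻ t in Ioc (0:ℝ) (1/2), ENNReal.ofReal (G (x + t • (z - x))) with hP
  have half : ∀ x ∈ B, ∀ z ∈ B, ENNReal.ofReal |w x - w (x + (1/2:ℝ) • (z - x))| ≤ P x z := by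
    intro x hx z hz
    have hseg : ∀ t ∈ Icc (0:ℝ) 1, x + t • (z - x) ∈ B := fun t ht =>
      (convex_ball y r).add_smul_sub_mem hx hz ht
    have hdf : ∀ t : ℝ, HasDerivAt (fun t : ℝ => w (x + t • (z - x)))
        (fderiv ℝ w (x + t • (z - x)) (z - x)) t := by
      intro t
      have e1 : HasDerivAt (fun t : ℝ => x + t • (z - x)) (z - x) t := by
        simpa using ((hasDerivAt_id t).smul_const (z - x)).const_add x
      exact ((hw.differentiable one_ne_zero _).hasFDerivAt.comp_hasDerivAt t e1)
    have hGc : Continuous (fun t : ℝ => 2 * r * D * G (x + t • (z - x))) := by fun_prop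
    have key := norm_sub_le_integral_of_norm_deriv_le_of_le (a := 0) (b := 1/2)
      (f := fun t : ℝ => w (x + t • (z - x))) (B := fun t : ℝ => 2 * r * D * G (x + t • (z - x)))
      (by norm_num) (fun t _ => (hdf t).continuousAt.continuousWithinAt)
      (fun t _ => (hdf t).differentiableAt.differentiableWithinAt)
      (Filter.Eventually.of_forall fun t ht => by
        rw [(hdf t).deriv]
        refine (ContinuousLinearMap.le_opNorm _ _).trans ?_
        have h1 := hD _ (hseg t ⟨ht.1.le, by linarith [ht.2]⟩)
        have h2 : ‖z - x‖ ≤ 2 * r := by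
          rw [← dist_eq_norm]
          have := dist_triangle_right z x y
          have h3 := Metric.mem_ball.1 hx
          have h4 := Metric.mem_ball.1 hz
          linarith
        calc _ ≤ (D * G (x + t • (z - x))) * (2 * r) :=
              mul_le_mul h1 h2 (norm_nonneg _) (mul_nonneg hD0 (hG0 _))
          _ = _ := by ring)
      (hGc.intervalIntegrable _ _)
    simp only [zero_smul, add_zero, Real.norm_eq_abs] at key
    rw [abs_sub_comm]
    refine (ENNReal.ofReal_le_ofReal key).trans ?_
    rw [intervalIntegral.integral_of_le (by norm_num), ofReal_integral_eq_lintegral_ofReal]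
    · rw [hP]; simp only
      rw [← lintegral_const_mul]
      · refine lintegral_mono fun t => ?_
        rw [ENNReal.ofReal_mul (by positivity)]
      · have : Continuous (fun t : ℝ => G (x + t • (z - x))) := by fun_prop
        exact this.measurable.ennreal_ofReal
    · exact (hGc.integrableOn_Icc).mono_set Ioc_subset_Icc_self
    · exact Filter.Eventually.of_forall fun t => mul_nonneg (by positivity) (hG0 _)
  have pw : ∀ x ∈ B, ∀ z ∈ B, ENNReal.ofReal |w x - w z| ≤ P x z + P z x := by
    intro x hx z hz
    refine le_trans ?_ (add_le_add (half x hx z hz) (half z hz x hx))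
    have : z + (1/2:ℝ) • (x - z) = x + (1/2:ℝ) • (z - x) := by module
    rw [this, ← ENNReal.ofReal_add (abs_nonneg _) (abs_nonneg _)]
    apply ENNReal.ofReal_le_ofReal
    rw [abs_sub_comm (w z)]
    exact abs_sub_le _ _ _
  have hPm : Measurable (Function.uncurry P) := by
    have h1 : Measurable (fun q : ((Fin N → ℝ) × (Fin N → ℝ)) × ℝ =>
        ENNReal.ofReal (G (q.1.1 + q.2 • (q.1.2 - q.1.1)))) := by
      have : Continuous (fun q : ((Fin N → ℝ) × (Fin N → ℝ)) × ℝ =>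
        (G (q.1.1 + q.2 • (q.1.2 - q.1.1)))) := by fun_prop
      exact this.measurable.ennreal_ofReal
    exact (h1.lintegral_prod_right' (ν := volume.restrict (Ioc (0:ℝ) (1/2)))).const_mul _
  have hin : ∀ z, ∫⁻ x in B, P x z ≤ ENNReal.ofReal (2 * r * D) * (ENNReal.ofReal (1/2) *
      (ENNReal.ofReal (2 ^ N) * ∫⁻ x, ENNReal.ofReal (G x))) := by
    intro z
    have h1 : Continuous (fun q : (Fin N → ℝ) × ℝ => G (q.1 + q.2 • (z - q.1))) := by fun_prop
    have h2 : Measurable (Function.uncurry fun (x : Fin N → ℝ) (t : ℝ) =>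
        ENNReal.ofReal (G (x + t • (z - x)))) := h1.measurable.ennreal_ofReal
    simp only [hP]
    have h3 : Measurable fun x : Fin N → ℝ =>
        ∫⁻ t in Ioc (0:ℝ) (1/2), ENNReal.ofReal (G (x + t • (z - x))) := h2.lintegral_prod_right'
    rw [lintegral_const_mul _ h3]
    gcongr
    rw [lintegral_lintegral_swap h2.aemeasurable]
    calc _ ≤ ∫⁻ t in Ioc (0:ℝ) (1/2), ENNReal.ofReal (2 ^ N) * ∫⁻ x, ENNReal.ofReal (G x) := by
          refine setLIntegral_mono' measurableSet_Ioc fun t ht => ?_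
          exact (setLIntegral_le_lintegral _ _).trans (cov_le hG z ht.2)
      _ = _ := by
          rw [setLIntegral_const, Real.volume_Ioc, sub_zero, mul_comm]
  have hQ : ∫⁻ z in B, ∫⁻ x in B, P x z ≤ ENNReal.ofReal (2 * r * D) * (ENNReal.ofReal (1/2) *
      (ENNReal.ofReal (2 ^ N) * ∫⁻ x, ENNReal.ofReal (G x))) * ENNReal.ofReal ((2 * r) ^ N) := by
    refine (lintegral_mono hin).trans ?_
    rw [setLIntegral_const, hB, Real.volume_pi_ball _ hr, Fintype.card_fin]
  have hsw : ∫⁻ z in B, ∫⁻ x in B, P z x = ∫⁻ z in B, ∫⁻ x in B, P x z :=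
    lintegral_lintegral_swap hPm.aemeasurable
  calc _ ≤ ∫⁻ z in B, ∫⁻ x in B, (P x z + P z x) :=
        setLIntegral_mono' measurableSet_ball fun z hz =>
          setLIntegral_mono' measurableSet_ball fun x hx => pw x hx z hz
    _ = (∫⁻ z in B, ∫⁻ x in B, P x z) + ∫⁻ z in B, ∫⁻ x in B, P z x := by
        rw [← lintegral_add_left]
        · congr 1; ext z
          rw [lintegral_add_left]
          exact hPm.comp (measurable_id.prodMk measurable_const)
        · exact (hPm.comp measurable_swap).lintegral_prod_right'
    _ ≤ _ := by
        rw [hsw]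
        refine (add_le_add hQ hQ).trans (le_of_eq ?_)
        rw [show D * (2 * r) * (2 * r) ^ N * 2 ^ N = 2 * ((2 * r * D) * ((1/2) * (2 ^ N) * (2 * r) ^ N)) by ring]
        have p1 : 0 ≤ 2 * r * D := by positivity
        have p2 : (0:ℝ) ≤ 1 / 2 * 2 ^ N := by positivity
        have p3 : (0:ℝ) ≤ 1 / 2 := by positivity
        rw [ENNReal.ofReal_mul two_pos.le, ENNReal.ofReal_mul p1,
          ENNReal.ofReal_mul p2, ENNReal.ofReal_mul p3]
        rw [ENNReal.ofReal_ofNat]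
        generalize ENNReal.ofReal (2 * r * D) = q1
        generalize ENNReal.ofReal ((2 * r) ^ N) = q2
        generalize ENNReal.ofReal (2 ^ N) = q3
        ring

lemma moll_deriv {N : ℕ} (y : Fin N → ℝ) {ρ : ℝ} {u g : (Fin N → ℝ) → ℝ}
    (hu : Integrable u) (hg : Integrable g)
    (H : ∀ ψ : (Fin N → ℝ) → ℝ, ContDiff ℝ (⊤ : ℕ∞) ψ → (∀ x, 0 ≤ ψ x) →
      tsupport ψ ⊆ Metric.ball y ρ → ∀ i : Fin N,
        |∫ x, u x * fderiv ℝ ψ x (Pi.single i 1)| ≤ ∫ x, ψ x * g x)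
    (φ : ContDiffBump (0 : Fin N → ℝ)) (x : Fin N → ℝ)
    (hx : Metric.closedBall x φ.rOut ⊆ Metric.ball y ρ) :
    ‖fderiv ℝ (φ.normed volume ⋆[ContinuousLinearMap.lsmul ℝ ℝ, volume] u) x‖ ≤
      N * (φ.normed volume ⋆[ContinuousLinearMap.lsmul ℝ ℝ, volume] g) x := by
  set η := φ.normed (volume : Measure (Fin N → ℝ)) with hη
  have hηs : ContDiff ℝ (⊤ : ℕ∞) η := φ.contDiff_normed
  have hη1 : ContDiff ℝ 1 η := φ.contDiff_normed (n := 1)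
  have hηc : HasCompactSupport η := φ.hasCompactSupport_normed
  have hη0 : ∀ x, 0 ≤ η x := φ.nonneg_normed
  have hsub : ContDiff ℝ (⊤ : ℕ∞) (fun t : Fin N → ℝ => x - t) := contDiff_const.sub contDiff_id
  set ψ : (Fin N → ℝ) → ℝ := fun t => η (x - t) with hψ
  have hψs : ContDiff ℝ (⊤ : ℕ∞) ψ := hηs.comp hsub
  have hψt : tsupport ψ ⊆ Metric.ball y ρ := by
    refine subset_trans (closure_minimal ?_ Metric.isClosed_closedBall) hx
    intro t ht
    have h1 : x - t ∈ Function.support η := ht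
    rw [hη, φ.support_normed_eq, mem_ball_zero_iff] at h1
    rw [Metric.mem_closedBall, dist_comm, dist_eq_norm]
    exact h1.le
  have hder : ∀ t v, fderiv ℝ ψ t v = - fderiv ℝ η (x - t) v := by
    intro t v
    have e1 : HasFDerivAt (fun t : Fin N → ℝ => x - t) (-(ContinuousLinearMap.id ℝ (Fin N → ℝ))) t :=
      (hasFDerivAt_id t).const_sub x
    have e2 := ((hη1.differentiable one_ne_zero (x - t)).hasFDerivAt).comp t e1
    have e3 : HasFDerivAt ψ _ t := e2
    rw [e3.fderiv]; simp
  have hfd := hηc.hasFDerivAt_convolution_left (ContinuousLinearMap.lsmul ℝ ℝ) hη1 hu.locallyIntegrable x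
  have hInt := (hηc.fderiv (𝕜 := ℝ)).convolutionExists_left
    ((ContinuousLinearMap.lsmul ℝ ℝ).precompL (Fin N → ℝ)) (hη1.continuous_fderiv one_ne_zero) hu.locallyIntegrable x
  have hcomp : ∀ i : Fin N, |fderiv ℝ (η ⋆[ContinuousLinearMap.lsmul ℝ ℝ, volume] u) x (Pi.single i 1)|
      ≤ (η ⋆[ContinuousLinearMap.lsmul ℝ ℝ, volume] g) x := by
    intro i
    rw [hfd.fderiv, convolution_def, ContinuousLinearMap.integral_apply hInt]
    have e1 : ∫ t, ((ContinuousLinearMap.precompL (Fin N → ℝ) (ContinuousLinearMap.lsmul ℝ ℝ)) (fderiv ℝ η t))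
        (u (x - t)) (Pi.single i 1) = ∫ t, fderiv ℝ η (x - t) (Pi.single i 1) * u t := by
      rw [← integral_sub_left_eq_self _ volume x]
      congr 1; ext t
      simp
    rw [e1, convolution_lsmul_swap]
    have e2 := H ψ hψs (fun t => hη0 _) hψt i
    have e3 : ∫ t, u t * fderiv ℝ ψ t (Pi.single i 1) =
        - ∫ t, fderiv ℝ η (x - t) (Pi.single i 1) * u t := by
      rw [← integral_neg]
      congr 1; ext t
      rw [hder]; ring
    rw [e3, abs_neg] at e2
    exact e2
  have hc0 : 0 ≤ (η ⋆[ContinuousLinearMap.lsmul ℝ ℝ, volume] g) x ∨ N = 0 := by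
    rcases Nat.eq_zero_or_pos N with h | h
    · exact Or.inr h
    · exact Or.inl ((abs_nonneg _).trans (hcomp ⟨0, h⟩))
  refine ContinuousLinearMap.opNorm_le_bound _ ?_ fun v => ?_
  · rcases hc0 with h | h
    · positivity
    · subst h; simp
  · have e : v = ∑ i, v i • (Pi.single i (1:ℝ) : Fin N → ℝ) := by
      ext j; simp [Finset.sum_apply, Pi.single_apply]
    conv_lhs => rw [e]
    rw [map_sum]
    refine (norm_sum_le _ _).trans ?_
    calc _ ≤ ∑ i : Fin N, ‖v‖ * (η ⋆[ContinuousLinearMap.lsmul ℝ ℝ, volume] g) x := by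
          refine Finset.sum_le_sum fun i _ => ?_
          rw [map_smul, norm_smul]
          exact mul_le_mul (norm_le_pi_norm v i) (hcomp i) (norm_nonneg _) (norm_nonneg _)
      _ = _ := by simp; ring

set_option maxHeartbeats 2000000 in
lemma core {N : ℕ} (y : Fin N → ℝ) {ρ r : ℝ} (hr : 0 < r) (hrρ : r < ρ) {u g : (Fin N → ℝ) → ℝ}
    (hum : Measurable u) (hgm : Measurable g)
    (hu : Integrable u) (hg : Integrable g) (hg0 : ∀ x, 0 ≤ g x)
    (H : ∀ ψ : (Fin N → ℝ) → ℝ, ContDiff ℝ (⊤ : ℕ∞) ψ → (∀ x, 0 ≤ ψ x) →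
      tsupport ψ ⊆ Metric.ball y ρ → ∀ i : Fin N,
        |∫ x, u x * fderiv ℝ ψ x (Pi.single i 1)| ≤ ∫ x, ψ x * g x)
    {h ℓ M : ℝ} (hl : h < ℓ) (hM : 0 < M) {Φ : ℝ → ℝ} (hΦ : ContDiff ℝ 1 Φ)
    (hΦ0 : ∀ t ≤ h, Φ t = 0) (hΦ1 : ∀ t, ℓ ≤ t → Φ t = ℓ - h) (hΦM : ∀ t, |deriv Φ t| ≤ M)
    (hΦd : ∀ t, ¬ (h < t ∧ t < ℓ) → deriv Φ t = 0) :
    ENNReal.ofReal (ℓ - h) * volume ({x | u x < h} ∩ Metric.ball y r) *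
      volume ({x | ℓ < u x} ∩ Metric.ball y r) ≤
    ENNReal.ofReal (N * (2 * r) * (2 * r) ^ N * 2 ^ N * M) *
      ∫⁻ x in {x | h < u x ∧ u x < ℓ}, ENNReal.ofReal (g x) := by
  set B := Metric.ball y r with hB
  set c : ℝ := N * (2 * r) * (2 * r) ^ N * 2 ^ N with hc
  have hc0 : 0 ≤ c := by positivity
  have hΦc : Continuous Φ := hΦ.continuous
  have hΦ'c : Continuous (deriv Φ) := hΦ.continuous_deriv le_rfl
  let φ : ℕ → ContDiffBump (0 : Fin N → ℝ) := fun n =>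
    { rIn := 1 / ((n:ℝ) + 1), rOut := 2 * (1 / ((n:ℝ) + 1)), rIn_pos := by positivity,
      rIn_lt_rOut := by
        have : 0 < 1 / ((n:ℝ) + 1) := by positivity
        linarith }
  have hφ : Tendsto (fun n => (φ n).rOut) atTop (𝓝 0) := by
    have := (tendsto_one_div_add_atTop_nhds_zero_nat (𝕜 := ℝ)).const_mul 2
    simpa [φ] using this
  have hφ' : ∀ᶠ n in atTop, (φ n).rOut ≤ 2 * (φ n).rIn := Filter.Eventually.of_forall fun n => le_rfl
  set un : ℕ → (Fin N → ℝ) → ℝ := fun n =>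
    (φ n).normed volume ⋆[ContinuousLinearMap.lsmul ℝ ℝ, volume] u with hun
  set gn : ℕ → (Fin N → ℝ) → ℝ := fun n =>
    (φ n).normed volume ⋆[ContinuousLinearMap.lsmul ℝ ℝ, volume] g with hgn
  have hut := ContDiffBump.ae_convolution_tendsto_right_of_locallyIntegrable (μ := volume) hφ hφ'
    hu.locallyIntegrable
  have hgt := ContDiffBump.ae_convolution_tendsto_right_of_locallyIntegrable (μ := volume) hφ hφ'
    hg.locallyIntegrable
  have hunC : ∀ n, ContDiff ℝ 1 (un n) := fun n =>
    ((φ n).hasCompactSupport_normed).contDiff_convolution_left _ ((φ n).contDiff_normed (n := 1))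
      hu.locallyIntegrable
  have hgnC : ∀ n, Continuous (gn n) := fun n =>
    (((φ n).hasCompactSupport_normed).contDiff_convolution_left (ContinuousLinearMap.lsmul ℝ ℝ)
      ((φ n).contDiff_normed (n := 1)) hg.locallyIntegrable).continuous
  have hgn0 : ∀ n x, 0 ≤ gn n x := fun n x =>
    integral_nonneg fun t => mul_nonneg ((φ n).nonneg_normed _) (hg0 _)
  set T := ∫⁻ x, ENNReal.ofReal (g x) with hT
  have hTfin : T ≠ ⊤ := by
    rw [hT, ← ofReal_integral_eq_lintegral_ofReal hg (Filter.Eventually.of_forall hg0)]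
    exact ENNReal.ofReal_ne_top
  have hgnT : ∀ n, ∫⁻ x, ENNReal.ofReal (gn n x) = T := by
    intro n
    have hi : Integrable (gn n) := (φ n).integrable_normed.integrable_convolution _ hg
    rw [hT, ← ofReal_integral_eq_lintegral_ofReal hg (Filter.Eventually.of_forall hg0),
      ← ofReal_integral_eq_lintegral_ofReal hi (Filter.Eventually.of_forall (hgn0 n))]
    congr 1
    have := integral_convolution (ContinuousLinearMap.lsmul ℝ ℝ) (μ := (volume : Measure (Fin N → ℝ)))
      (ν := volume) ((φ n).integrable_normed (μ := volume)) hg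
    rw [(φ n).integral_normed] at this
    simpa using this
  set G : ℕ → (Fin N → ℝ) → ℝ := fun n x => |deriv Φ (un n x)| * gn n x with hG
  have hGc : ∀ n, Continuous (G n) := fun n =>
    ((hΦ'c.comp (hunC n).continuous).abs).mul (hgnC n)
  have hG0 : ∀ n x, 0 ≤ G n x := fun n x => mul_nonneg (abs_nonneg _) (hgn0 n x)
  have hsplit : ∀ (a b : (Fin N → ℝ) → ℝ), Measurable a → Measurable b → (∀ x, 0 ≤ b x) →
      (∀ x, |a x| ≤ M) →
      ENNReal.ofReal c * (∫⁻ x, ENNReal.ofReal (|a x| * b x)) +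
        ∫⁻ x, ENNReal.ofReal (c * (M * b x - |a x| * b x)) =
      ENNReal.ofReal (c * M) * ∫⁻ x, ENNReal.ofReal (b x) := by
    intro a b ha hb hb0 haM
    have m1 : Measurable fun x => ENNReal.ofReal (|a x| * b x) := by fun_prop
    have m2 : Measurable fun x => ENNReal.ofReal (b x) := by fun_prop
    rw [← lintegral_const_mul _ m1, ← lintegral_const_mul _ m2, ← lintegral_add_left (m1.const_mul _)]
    congr 1; ext x
    have h1 : 0 ≤ |a x| * b x := mul_nonneg (abs_nonneg _) (hb0 x)
    have h2 : 0 ≤ M * b x - |a x| * b x := by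
      rw [← sub_mul]; exact mul_nonneg (sub_nonneg.2 (haM x)) (hb0 x)
    rw [← ENNReal.ofReal_mul hc0, ← ENNReal.ofReal_add (mul_nonneg hc0 h1) (mul_nonneg hc0 h2),
      ← ENNReal.ofReal_mul (mul_nonneg hc0 hM.le)]
    congr 1; ring
  set I : ℕ → ENNReal := fun n => ∫⁻ z in B, ∫⁻ x in B, ENNReal.ofReal |Φ (un n x) - Φ (un n z)| with hI
  set J : ℕ → ENNReal := fun n => ∫⁻ x, ENNReal.ofReal (c * (M * gn n x - G n x)) with hJ
  have hIJ : ∀ᶠ n in atTop, I n + J n ≤ ENNReal.ofReal (c * M) * T := by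
    have hev : ∀ᶠ n in atTop, (φ n).rOut < ρ - r := hφ.eventually_lt_const (sub_pos.2 hrρ)
    filter_upwards [hev] with n hn
    have hp : I n ≤ ENNReal.ofReal c * ∫⁻ x, ENNReal.ofReal (G n x) := by
      refine poincare y hr (w := fun x => Φ (un n x)) (hΦ.comp (hunC n)) (hGc n) (hG0 n)
        (Nat.cast_nonneg N) fun x hx => ?_
      have hsub : Metric.closedBall x (φ n).rOut ⊆ Metric.ball y ρ := by
        intro t ht
        have h1 := Metric.mem_ball.1 hx
        have h2 := Metric.mem_closedBall.1 ht
        have h3 := dist_triangle t x y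
        exact Metric.mem_ball.2 (by linarith)
      have hd := moll_deriv y hu hg H (φ n) x hsub
      have e1 : HasFDerivAt (fun x => Φ (un n x)) (deriv Φ (un n x) • fderiv ℝ (un n) x) x :=
        ((hΦ.differentiable one_ne_zero _).hasDerivAt).comp_hasFDerivAt x
          ((hunC n).differentiable one_ne_zero x).hasFDerivAt
      rw [e1.fderiv, norm_smul, Real.norm_eq_abs]
      calc _ ≤ |deriv Φ (un n x)| * (N * gn n x) := mul_le_mul_of_nonneg_left hd (abs_nonneg _)
        _ = _ := by simp only [hG]; ring
    calc I n + J n ≤ _ := add_le_add hp le_rfl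
      _ = _ := by
        rw [← hgnT n]
        exact hsplit (fun x => deriv Φ (un n x)) (gn n) (hΦ'c.comp (hunC n).continuous).measurable
          (hgnC n).measurable (hgn0 n) (fun x => hΦM _)
  have hlim := liminf_add_le_of_le hIJ
  have hLI : ENNReal.ofReal (ℓ - h) * volume ({x | u x < h} ∩ B) * volume ({x | ℓ < u x} ∩ B) ≤
      liminf I atTop := by
    have mc : ∀ n, Continuous (fun p : (Fin N → ℝ) × (Fin N → ℝ) => |Φ (un n p.2) - Φ (un n p.1)|) := by
      intro n
      have := (hunC n).continuous
      fun_prop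
    have mm : ∀ n, Measurable (fun p : (Fin N → ℝ) × (Fin N → ℝ) =>
        ENNReal.ofReal |Φ (un n p.2) - Φ (un n p.1)|) := fun n => (mc n).measurable.ennreal_ofReal
    have hA : MeasurableSet ({x | u x < h} ∩ B) := (measurableSet_lt hum measurable_const).inter measurableSet_ball
    have hA' : MeasurableSet ({x | ℓ < u x} ∩ B) := (measurableSet_lt measurable_const hum).inter measurableSet_ball
    have hz : ∀ᵐ z, z ∈ {x | ℓ < u x} ∩ B → ENNReal.ofReal (ℓ - h) * volume ({x | u x < h} ∩ B) ≤
        liminf (fun n => ∫⁻ x in B, ENNReal.ofReal |Φ (un n x) - Φ (un n z)|) atTop := by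
      filter_upwards [hut] with z hz hzB
      refine le_trans ?_ (lintegral_liminf_le fun n => (mm n).comp (measurable_const.prodMk measurable_id))
      rw [← setLIntegral_const]
      refine le_trans ?_ (lintegral_mono_set (inter_subset_right (s := {x | u x < h})))
      refine setLIntegral_mono_ae' hA ?_
      filter_upwards [hut] with x hx hxA
      have t1 : Tendsto (fun n => ENNReal.ofReal |Φ (un n x) - Φ (un n z)|) atTop
          (𝓝 (ENNReal.ofReal |Φ (u x) - Φ (u z)|)) :=
        ENNReal.tendsto_ofReal ((((hΦc.tendsto _).comp hx).sub ((hΦc.tendsto _).comp hz)).abs)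
      have t2 := t1.liminf_eq
      rw [t2, hΦ0 _ (le_of_lt hxA.1), hΦ1 _ (le_of_lt hzB.1), zero_sub, abs_neg]
      exact ENNReal.ofReal_le_ofReal (le_abs_self _)
    refine le_trans ?_ (lintegral_liminf_le fun n => (mm n).lintegral_prod_right')
    rw [← setLIntegral_const]
    refine le_trans ?_ (lintegral_mono_set (inter_subset_right (s := {x | ℓ < u x})))
    exact setLIntegral_mono_ae' hA' hz
  have hLJ : ∫⁻ x, ENNReal.ofReal (c * (M * g x - |deriv Φ (u x)| * g x)) ≤ liminf J atTop := by
    have mm : ∀ n, Measurable fun x => ENNReal.ofReal (c * (M * gn n x - G n x)) := by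
      intro n
      have h1 := hgnC n
      have h2 := hGc n
      have : Continuous fun x => (c * (M * gn n x - G n x)) := by fun_prop
      exact this.measurable.ennreal_ofReal
    refine le_trans (lintegral_mono_ae ?_) (lintegral_liminf_le mm)
    filter_upwards [hut, hgt] with x hx hx'
    refine le_of_eq (Tendsto.liminf_eq ?_).symm
    refine ENNReal.tendsto_ofReal (Tendsto.const_mul _ ((hx'.const_mul _).sub (Tendsto.mul ?_ hx')))
    exact ((hΦ'c.tendsto _).comp hx).abs
  have hfin := hsplit (fun x => deriv Φ (u x)) g (hΦ'c.measurable.comp hum) hgm hg0 (fun x => hΦM _)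
  have hne : ∫⁻ x, ENNReal.ofReal (c * (M * g x - |deriv Φ (u x)| * g x)) ≠ ⊤ := by
    refine ne_top_of_le_ne_top ?_ (le_add_left le_rfl |>.trans hfin.le)
    exact ENNReal.mul_ne_top ENNReal.ofReal_ne_top hTfin
  have hmain : ENNReal.ofReal (ℓ - h) * volume ({x | u x < h} ∩ B) * volume ({x | ℓ < u x} ∩ B) ≤
      ENNReal.ofReal c * (∫⁻ x, ENNReal.ofReal (|deriv Φ (u x)| * g x)) := by
    have := (add_le_add hLI hLJ).trans hlim
    rw [hT, ← hfin] at this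
    exact (ENNReal.add_le_add_iff_right hne).1 this
  refine hmain.trans ?_
  rw [ENNReal.ofReal_mul hc0, mul_assoc]
  gcongr
  have hS : MeasurableSet {x | h < u x ∧ u x < ℓ} :=
    (measurableSet_lt measurable_const hum).inter (measurableSet_lt hum measurable_const)
  rw [← lintegral_const_mul _ hgm.ennreal_ofReal, ← lintegral_indicator hS]
  refine lintegral_mono fun x => ?_
  by_cases hx : h < u x ∧ u x < ℓ
  · rw [indicator_of_mem (show x ∈ {x | h < u x ∧ u x < ℓ} from hx), ← ENNReal.ofReal_mul hM.le]
    exact ENNReal.ofReal_le_ofReal (mul_le_mul_of_nonneg_right (hΦM _) (hg0 x))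
  · simp only
    rw [hΦd _ hx]; simp

lemma cube_eq_ball (N : ℕ) (y : Fin N → ℝ) {ρ : ℝ} (hρ : 0 < ρ) : cube N y ρ = Metric.ball y ρ := by
  ext x
  rw [Metric.mem_ball, dist_pi_lt_iff hρ]
  rfl

lemma core_limit {N : ℕ} (y : Fin N → ℝ) {ρ : ℝ} (hρ : 0 < ρ) {S S' : Set (Fin N → ℝ)} {a R : ENNReal}
    (ha : a ≠ ⊤)
    (h : ∀ r, 0 < r → r < ρ → a * volume (S ∩ Metric.ball y r) * volume (S' ∩ Metric.ball y r) ≤ R) :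
    a * volume (S ∩ Metric.ball y ρ) * volume (S' ∩ Metric.ball y ρ) ≤ R := by
  have hsq : ∀ n : ℕ, 0 < 1 / ((n:ℝ) + 1) := fun n => by positivity
  set r : ℕ → ℝ := fun n => ρ * (1 - 1 / ((n:ℝ) + 1)) with hr
  have hlt : ∀ n, r n < ρ := by
    intro n
    have := mul_pos hρ (hsq n)
    simp only [hr]; linarith
  have hrm : Monotone r := by
    intro m n hmn
    simp only [hr]
    gcongr
  have hrt : Tendsto r atTop (𝓝 ρ) := by
    have := ((tendsto_one_div_add_atTop_nhds_zero_nat (𝕜 := ℝ)).const_sub 1).const_mul ρ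
    simpa [hr] using this
  have hU : ∀ A : Set (Fin N → ℝ), Tendsto (fun n => volume (A ∩ Metric.ball y (r n))) atTop
      (𝓝 (volume (A ∩ Metric.ball y ρ))) := by
    intro A
    have e : A ∩ Metric.ball y ρ = ⋃ n, A ∩ Metric.ball y (r n) := by
      rw [← inter_iUnion]
      congr 1
      ext x
      simp only [Metric.mem_ball, mem_iUnion]
      constructor
      · intro hx
        exact (hrt.eventually_const_lt hx).exists
      · rintro ⟨n, hn⟩
        exact hn.trans (hlt n)
    rw [e]
    exact tendsto_measure_iUnion_atTop fun m n hmn =>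
      inter_subset_inter_right _ (Metric.ball_subset_ball (hrm hmn))
  have hf : ∀ A : Set (Fin N → ℝ), volume (A ∩ Metric.ball y ρ) ≠ ⊤ := fun A =>
    ne_top_of_le_ne_top measure_ball_lt_top.ne (measure_mono inter_subset_right)
  have ht := ENNReal.Tendsto.mul (ENNReal.Tendsto.const_mul (hU S) (Or.inr ha)) (Or.inr (hf S')) (hU S')
    (Or.inr (ENNReal.mul_ne_top ha (hf S)))
  refine le_of_tendsto ht ?_
  filter_upwards [hrt.eventually_const_lt hρ] with n hn
  exact h _ hn (hlt n)

end helpers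

/-- discrete isoperimetric / DeGiorgi inequality: There is a
dimensional constant `C(N)` such that for every `u ∈ W^{1,1}(K_ρ)` (with weak
gradient `Du`, characterized by integration by parts against test functions) and
every pair of levels `0 < h < ℓ`, provided `|[u > ℓ] ∩ K_ρ| > 0`,
`(ℓ-h)|[u<h] ∩ K_ρ| ≤ C(N) ρ^{N+1}/|[u>ℓ] ∩ K_ρ| · ∫_{[h<u<ℓ] ∩ K_ρ} |Du| dx`. -/
theorem stmt14 (N : ℕ) :
    ∃ C : ℝ, 0 < C ∧
      ∀ (y : Fin N → ℝ) (ρ : ℝ), 0 < ρ →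
        ∀ (u : (Fin N → ℝ) → ℝ) (Du : (Fin N → ℝ) → EuclideanSpace ℝ (Fin N)),
          IntegrableOn u (cube N y ρ) volume →
          IntegrableOn (fun x => ‖Du x‖) (cube N y ρ) volume →
          (∀ ψ : (Fin N → ℝ) → ℝ, ContDiff ℝ (⊤ : ℕ∞) ψ → tsupport ψ ⊆ cube N y ρ →
            ∀ i : Fin N,
              (∫ x in cube N y ρ, u x * fderiv ℝ ψ x (Pi.single i 1)) =
                -∫ x in cube N y ρ, ψ x * Du x i) →
          ∀ h ℓ : ℝ, 0 < h → h < ℓ →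
            0 < (volume ({x | ℓ < u x} ∩ cube N y ρ)).toReal →
            (ℓ - h) * (volume ({x | u x < h} ∩ cube N y ρ)).toReal ≤
              C * ρ ^ (N + 1) / (volume ({x | ℓ < u x} ∩ cube N y ρ)).toReal *
                ∫ x in {x | h < u x ∧ u x < ℓ} ∩ cube N y ρ, ‖Du x‖ := by
  obtain ⟨M, hM, hcut⟩ := exists_cutoff
  refine ⟨N * 2 * 2 ^ N * 2 ^ N * M + 1, by positivity, ?_⟩
  intro y ρ hρ u Du hu hDu hweak h ℓ hh hl hpos
  obtain ⟨Φ, hΦ, hΦ0, hΦ1, hΦM, hΦd⟩ := hcut h ℓ hl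
  rw [cube_eq_ball N y hρ] at *
  set K := Metric.ball y ρ with hK
  have hKm : MeasurableSet K := measurableSet_ball
  have hum0 := hu.aestronglyMeasurable.stronglyMeasurable_mk.measurable
  have hue := hu.aestronglyMeasurable.ae_eq_mk
  have hgm0 := hDu.aestronglyMeasurable.stronglyMeasurable_mk.measurable
  have hge := hDu.aestronglyMeasurable.ae_eq_mk
  set u0 := hu.aestronglyMeasurable.mk u with hu0
  set g0 := hDu.aestronglyMeasurable.mk (fun x => ‖Du x‖) with hg0
  have hug : u =ᵐ[volume.restrict K] K.indicator u0 := by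
    filter_upwards [hue, ae_restrict_mem hKm] with x h1 h2
    rw [indicator_of_mem h2, h1]
  have hgg : (fun x => ‖Du x‖) =ᵐ[volume.restrict K] K.indicator (fun x => |g0 x|) := by
    filter_upwards [hge, ae_restrict_mem hKm] with x h1 h2
    rw [indicator_of_mem h2, ← h1, abs_of_nonneg (norm_nonneg _)]
  set u' := K.indicator u0 with hu'
  set g' := K.indicator (fun x => |g0 x|) with hg'
  have hum : Measurable u' := hum0.indicator hKm
  have hgm : Measurable g' := hgm0.abs.indicator hKm
  have hui : Integrable u' := by
    rw [hu', integrable_indicator_iff hKm]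
    exact Integrable.congr hu hue
  have hgi : Integrable g' := by
    rw [hg', integrable_indicator_iff hKm]
    exact (Integrable.congr hDu hge).abs
  have hg'0 : ∀ x, 0 ≤ g' x := fun x => indicator_nonneg (fun _ _ => abs_nonneg _) x
  have H : ∀ ψ : (Fin N → ℝ) → ℝ, ContDiff ℝ (⊤ : ℕ∞) ψ → (∀ x, 0 ≤ ψ x) →
      tsupport ψ ⊆ Metric.ball y ρ → ∀ i : Fin N,
        |∫ x, u' x * fderiv ℝ ψ x (Pi.single i 1)| ≤ ∫ x, ψ x * g' x := by
    intro ψ hψ hψ0 hψt i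
    have e1 : ∫ x, u' x * fderiv ℝ ψ x (Pi.single i 1) = ∫ x in K, u x * fderiv ℝ ψ x (Pi.single i 1) := by
      rw [← setIntegral_eq_integral_of_forall_compl_eq_zero (s := K)]
      · refine integral_congr_ae ?_
        filter_upwards [hug] with x hx
        rw [hx]
      · intro x hx
        rw [hu', indicator_of_notMem hx, zero_mul]
    have e2 : ∫ x, ψ x * g' x = ∫ x in K, ψ x * g' x := by
      rw [← setIntegral_eq_integral_of_forall_compl_eq_zero (s := K)]
      intro x hx
      rw [hg', indicator_of_notMem hx, mul_zero]
    have hcs : HasCompactSupport ψ :=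
      Metric.isCompact_of_isClosed_isBounded (isClosed_tsupport ψ) (Metric.isBounded_ball.subset hψt)
    obtain ⟨Cψ, hCψ⟩ := hcs.exists_bound_of_continuous hψ.continuous
    have hInt : Integrable (fun x => ψ x * g' x) :=
      hgi.bdd_mul hψ.continuous.aestronglyMeasurable (Filter.Eventually.of_forall hCψ)
    rw [e1, hweak ψ hψ hψt i, abs_neg, e2, ← Real.norm_eq_abs]
    refine norm_integral_le_of_norm_le hInt.integrableOn ?_
    filter_upwards [hgg] with x hx
    rw [norm_mul, Real.norm_of_nonneg (hψ0 x), ← hx]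
    exact mul_le_mul_of_nonneg_left (PiLp.norm_apply_le (Du x) i) (hψ0 x)
  have hug' : ∀ᵐ x, x ∈ K → u x = u' x := (ae_restrict_iff' hKm).1 hug
  have v1 : volume ({x | u x < h} ∩ K) = volume ({x | u' x < h} ∩ K) := by
    refine measure_congr ?_
    filter_upwards [hug'] with x hx
    refine propext ⟨fun ⟨p, q⟩ => ⟨?_, q⟩, fun ⟨p, q⟩ => ⟨?_, q⟩⟩
    · simpa only [mem_setOf_eq, hx q] using p
    · simpa only [mem_setOf_eq, hx q] using p
  have v2 : volume ({x | ℓ < u x} ∩ K) = volume ({x | ℓ < u' x} ∩ K) := by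
    refine measure_congr ?_
    filter_upwards [hug'] with x hx
    refine propext ⟨fun ⟨p, q⟩ => ⟨?_, q⟩, fun ⟨p, q⟩ => ⟨?_, q⟩⟩
    · simpa only [mem_setOf_eq, hx q] using p
    · simpa only [mem_setOf_eq, hx q] using p
  have v3 : ({x | h < u x ∧ u x < ℓ} ∩ K : Set (Fin N → ℝ)) =ᵐ[volume]
      ({x | h < u' x ∧ u' x < ℓ} ∩ K : Set (Fin N → ℝ)) := by
    filter_upwards [hug'] with x hx
    refine propext ⟨fun ⟨p, q⟩ => ⟨?_, q⟩, fun ⟨p, q⟩ => ⟨?_, q⟩⟩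
    · simpa only [mem_setOf_eq, hx q] using p
    · simpa only [mem_setOf_eq, hx q] using p
  have v4 : ∫ x in {x | h < u x ∧ u x < ℓ} ∩ K, ‖Du x‖ = ∫ x in {x | h < u' x ∧ u' x < ℓ}, g' x := by
    rw [setIntegral_congr_set v3]
    have : ∫ x in {x | h < u' x ∧ u' x < ℓ} ∩ K, ‖Du x‖ = ∫ x in {x | h < u' x ∧ u' x < ℓ} ∩ K, |g0 x| := by
      refine integral_congr_ae (ae_restrict_of_ae_restrict_of_subset inter_subset_right ?_)
      filter_upwards [hge] with x hx
      rw [← hx, abs_of_nonneg (norm_nonneg _)]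
    rw [this, hg', setIntegral_indicator hKm]
  rw [v2] at hpos
  rw [v1, v2, v4]
  set Q := ∫ x in {x | h < u' x ∧ u' x < ℓ}, g' x with hQ
  have hQ0 : 0 ≤ Q := integral_nonneg hg'0
  have hQe : ∫⁻ x in {x | h < u' x ∧ u' x < ℓ}, ENNReal.ofReal (g' x) = ENNReal.ofReal Q :=
    (ofReal_integral_eq_lintegral_ofReal hgi.integrableOn (Filter.Eventually.of_forall hg'0)).symm
  have hfinal := core_limit y hρ (S := {x | u' x < h}) (S' := {x | ℓ < u' x}) (a := ENNReal.ofReal (ℓ - h))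
    (R := ENNReal.ofReal ((N * 2 * 2 ^ N * 2 ^ N * M + 1) * ρ ^ (N + 1)) * ENNReal.ofReal Q)
    ENNReal.ofReal_ne_top (by
      intro r hr hrρ
      refine (core y hr hrρ hum hgm hui hgi hg'0 H hl hM hΦ hΦ0 hΦ1 hΦM hΦd).trans ?_
      rw [hQe]
      refine mul_le_mul' (ENNReal.ofReal_le_ofReal ?_) le_rfl
      calc (N:ℝ) * (2 * r) * (2 * r) ^ N * 2 ^ N * M = (N * 2 * 2 ^ N * 2 ^ N * M) * r ^ (N + 1) := by
            rw [mul_pow]; ring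
        _ ≤ (N * 2 * 2 ^ N * 2 ^ N * M) * ρ ^ (N + 1) := by gcongr
        _ ≤ _ := by
            have : 0 < ρ ^ (N + 1) := by positivity
            nlinarith)
  have hreal := ENNReal.toReal_mono (ENNReal.mul_ne_top ENNReal.ofReal_ne_top ENNReal.ofReal_ne_top) hfinal
  have p1 : (0:ℝ) ≤ (N * 2 * 2 ^ N * 2 ^ N * M + 1) * ρ ^ (N + 1) := by positivity
  rw [ENNReal.toReal_mul, ENNReal.toReal_mul, ENNReal.toReal_mul, ENNReal.toReal_ofReal (sub_pos.2 hl).le,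
    ENNReal.toReal_ofReal p1, ENNReal.toReal_ofReal hQ0] at hreal
  rw [div_mul_eq_mul_div, le_div_iff₀ hpos]
  exact hreal
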